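/- HOSVD simultaneously diagonalizes the one-body reduced density matrices: let ψ(i) = ∑_j (∏_{m} U^(m)(i m, j m)) · T(j) for all index tuples i, where each U^(m) is unitary and T satisfies the all-orthogonality conditions (for every mode n and α ≠ β, ∑ over the remaining indices of conj(T(j with n-th index α)) · T(j with n-th index β) = 0). Then for every mode n, the one-body reduced density matrix of ψ satisfies ρ_n = U^(n) · D^(n) · U^(n)†, where D^(n) is the diagonal matrix whose α-th diagonal entry is the squared n-mode singular value σ_α^(n)2 = ∑ over the remaining indices of |T(j with n-th index α)|². -/

import Mathlib

open scoped ComplexConjugate Matrix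

/-- Insert an index `k` at position `n` into a tuple `A` of the remaining indices,
producing a full index tuple. -/
def insertIdx {N : ℕ} {I : Fin N → ℕ} (n : Fin N) (k : Fin (I n))
    (A : ∀ m : {m : Fin N // m ≠ n}, Fin (I m.1)) : ∀ m : Fin N, Fin (I m) :=
  fun m => if h : m = n then (h.symm ▸ k) else A ⟨m, h⟩

/-- The one-body reduced density matrix `ρ_n` of a tensor `ψ`. -/
noncomputable def oneBodyRDM {N : ℕ} {I : Fin N → ℕ} (ψ : (∀ n : Fin N, Fin (I n)) → ℂ)
    (n : Fin N) : Matrix (Fin (I n)) (Fin (I n)) ℂ :=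
  Matrix.of fun α β => ∑ A : ∀ m : {m : Fin N // m ≠ n}, Fin (I m.1),
    ψ (insertIdx n α A) * conj (ψ (insertIdx n β A))

/-- The Kronecker product of a finite family of square matrices. -/
def piKronecker {ι : Type*} [Fintype ι] {κ : ι → Type*} (U : ∀ m, Matrix (κ m) (κ m) ℂ) :
    Matrix (∀ m, κ m) (∀ m, κ m) ℂ :=
  Matrix.of fun A B => ∏ m, U m (A m) (B m)

theorem piKronecker_mul_conjTranspose {ι : Type*} [Fintype ι] [DecidableEq ι] {κ : ι → Type*}
    [∀ m, Fintype (κ m)] [∀ m, DecidableEq (κ m)] (U : ∀ m, Matrix (κ m) (κ m) ℂ)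
    (hU : ∀ m, U m * (U m)ᴴ = 1) :
    piKronecker U * (piKronecker U)ᴴ = 1 := by
  ext A B
  have hentry : ∀ m, ∑ c, U m (A m) c * conj (U m (B m) c) = if A m = B m then 1 else 0 := by
    intro m
    have h := congrFun (congrFun (hU m) (A m)) (B m)
    simpa [Matrix.mul_apply, Matrix.one_apply] using h
  calc (piKronecker U * (piKronecker U)ᴴ) A B
      = ∑ C : ∀ m, κ m, ∏ m, U m (A m) (C m) * conj (U m (B m) (C m)) := by
        simp [Matrix.mul_apply, piKronecker, Finset.prod_mul_distrib]
    _ = ∏ m, ∑ c, U m (A m) c * conj (U m (B m) c) := by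
        rw [Finset.prod_univ_sum, Fintype.piFinset_univ]
    _ = (1 : Matrix (∀ m, κ m) (∀ m, κ m) ℂ) A B := by
        simp only [hentry, Matrix.one_apply, funext_iff]
        exact Fintype.prod_ite_zero.trans (by simp)

/-- The `n`-mode unfolding of a tensor. -/
def unfolding {N : ℕ} {I : Fin N → ℕ} (ψ : (∀ n : Fin N, Fin (I n)) → ℂ) (n : Fin N) :
    Matrix (Fin (I n)) (∀ m : {m : Fin N // m ≠ n}, Fin (I m.1)) ℂ :=
  Matrix.of fun α A => ψ (insertIdx n α A)

theorem oneBodyRDM_eq_unfolding_mul_conjTranspose {N : ℕ} {I : Fin N → ℕ}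
    (ψ : (∀ n : Fin N, Fin (I n)) → ℂ) (n : Fin N) :
    oneBodyRDM ψ n = unfolding ψ n * (unfolding ψ n)ᴴ := by
  ext α β
  simp [oneBodyRDM, unfolding, Matrix.mul_apply]

theorem insertIdx_self {N : ℕ} {I : Fin N → ℕ} (n : Fin N) (k : Fin (I n))
    (A : ∀ m : {m : Fin N // m ≠ n}, Fin (I m.1)) : insertIdx n k A n = k := by
  simp [insertIdx]

theorem insertIdx_of_ne {N : ℕ} {I : Fin N → ℕ} (n : Fin N) (k : Fin (I n))
    (A : ∀ m : {m : Fin N // m ≠ n}, Fin (I m.1)) (m : {m : Fin N // m ≠ n}) :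
    insertIdx n k A m.1 = A m := by
  simp [insertIdx, m.2]

theorem sum_eq_sum_insertIdx {N : ℕ} {I : Fin N → ℕ} (n : Fin N)
    (f : (∀ m : Fin N, Fin (I m)) → ℂ) :
    ∑ j, f j = ∑ k, ∑ A, f (insertIdx n k A) := by
  rw [← (Equiv.piSplitAt n fun m => Fin (I m)).symm.sum_comp, Fintype.sum_prod_type]
  rfl

theorem unfolding_multilinear_mul {N : ℕ} {I : Fin N → ℕ} (ψ T : (∀ n : Fin N, Fin (I n)) → ℂ)
    (U : ∀ m : Fin N, Matrix (Fin (I m)) (Fin (I m)) ℂ)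
    (hdec : ∀ i : ∀ n : Fin N, Fin (I n),
      ψ i = ∑ j : ∀ n : Fin N, Fin (I n), (∏ m : Fin N, U m (i m) (j m)) * T j)
    (n : Fin N) :
    unfolding ψ n =
      U n * unfolding T n * (piKronecker fun m : {m : Fin N // m ≠ n} => U m.1)ᵀ := by
  ext α A
  simp only [unfolding, piKronecker, Matrix.mul_apply, Matrix.of_apply, Matrix.transpose_apply,
    hdec, sum_eq_sum_insertIdx n, Finset.sum_mul]
  rw [Finset.sum_comm]
  refine Finset.sum_congr rfl fun B _ => Finset.sum_congr rfl fun k _ => ?_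
  rw [← Fintype.prod_subtype_mul_prod_subtype (fun m => m ≠ n)]
  have hsub : ∏ m : {m : Fin N // ¬ m ≠ n}, U m.1 (insertIdx n α A m.1) (insertIdx n k B m.1)
      = U n α k := by
    have : Subsingleton {m : Fin N // ¬ m ≠ n} :=
      ⟨fun a b => Subtype.ext ((not_not.mp a.2).trans (not_not.mp b.2).symm)⟩
    rw [Fintype.prod_subsingleton _ (⟨n, by simp⟩ : {m : Fin N // ¬ m ≠ n})]
    simp only [insertIdx_self]
  rw [hsub]
  simp only [insertIdx_of_ne]
  ring

/-- All-orthogonality of mode `n` says that the Gram matrix of the `n`-mode unfolding is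
diagonal. -/
theorem unfolding_mul_conjTranspose_eq_diagonal {N : ℕ} {I : Fin N → ℕ}
    (T : (∀ n : Fin N, Fin (I n)) → ℂ) (n : Fin N)
    (hortho : ∀ α β : Fin (I n), α ≠ β →
      ∑ A : ∀ m : {m : Fin N // m ≠ n}, Fin (I m.1),
        conj (T (insertIdx n α A)) * T (insertIdx n β A) = 0) :
    unfolding T n * (unfolding T n)ᴴ =
      Matrix.diagonal (fun α : Fin (I n) =>
        ((∑ A : ∀ m : {m : Fin N // m ≠ n}, Fin (I m.1),
          ‖T (insertIdx n α A)‖ ^ 2 : ℝ) : ℂ)) := by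
  ext α β
  by_cases h : α = β
  · subst h
    simp [Matrix.mul_apply, unfolding, Complex.mul_conj']
  · rw [Matrix.diagonal_apply_ne _ h, ← hortho β α (Ne.symm h)]
    simp [Matrix.mul_apply, unfolding, mul_comm]

/-- HOSVD simultaneously diagonalizes the one-body reduced density
matrices: `ρ_n = U^(n) · D^(n) · U^(n)†`, where `D^(n)` is diagonal with entries
the squared `n`-mode singular values. -/
theorem hosvd_diagonalizes_one_body_rdm {N : ℕ} {I : Fin N → ℕ}
    (ψ T : (∀ n : Fin N, Fin (I n)) → ℂ)
    (U : ∀ m : Fin N, Matrix (Fin (I m)) (Fin (I m)) ℂ)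
    (hU : ∀ m : Fin N, U m * (U m)ᴴ = 1)
    (hdec : ∀ i : ∀ n : Fin N, Fin (I n),
      ψ i = ∑ j : ∀ n : Fin N, Fin (I n), (∏ m : Fin N, U m (i m) (j m)) * T j)
    (hortho : ∀ n : Fin N, ∀ α β : Fin (I n), α ≠ β →
      ∑ A : ∀ m : {m : Fin N // m ≠ n}, Fin (I m.1),
        conj (T (insertIdx n α A)) * T (insertIdx n β A) = 0)
    (n : Fin N) :
    oneBodyRDM ψ n =
      U n *
        Matrix.diagonal (fun α : Fin (I n) =>
          ((∑ A : ∀ m : {m : Fin N // m ≠ n}, Fin (I m.1),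
            ‖T (insertIdx n α A)‖ ^ 2 : ℝ) : ℂ)) *
        (U n)ᴴ := by
  set K := piKronecker fun m : {m : Fin N // m ≠ n} => U m.1
  have hK : Kᵀ * Kᵀᴴ = 1 := by
    have h : Kᴴ * K = 1 :=
      mul_eq_one_comm.mp (piKronecker_mul_conjTranspose _ fun m => hU m.1)
    rw [Matrix.conjTranspose_transpose_eq_transpose_conjTranspose, ← Matrix.transpose_mul, h,
      Matrix.transpose_one]
  rw [← unfolding_mul_conjTranspose_eq_diagonal T n (hortho n),
    oneBodyRDM_eq_unfolding_mul_conjTranspose, unfolding_multilinear_mul ψ T U hdec n]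
  calc U n * unfolding T n * Kᵀ * (U n * unfolding T n * Kᵀ)ᴴ
      = U n * unfolding T n * (Kᵀ * Kᵀᴴ) * (unfolding T n)ᴴ * (U n)ᴴ := by
        simp only [Matrix.conjTranspose_mul, Matrix.mul_assoc]
    _ = U n * (unfolding T n * (unfolding T n)ᴴ) * (U n)ᴴ := by
        rw [hK, Matrix.mul_one, Matrix.mul_assoc (U n)]
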